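/- arXiv:1312.4581 — 2 statements merged into one kernel-verified Lean document; each statement's English description precedes it below -/
import Mathlib

section
/- (Flat Martinet structure bracket relations.) Let U = {(x,y,z) ∈ ℝ³ : y ≠ 0} and define smooth vector fields on U by X1(x,y,z) = (1, 0, y²/2), X2(x,y,z) = (0, 1, −x·y/2), and X0(x,y,z) = (−1/y, 0, y). Then at every point p = (x,y,z) ∈ U: ⁅X2,X1⁆(p) = (1/y)·X1(p) + X0(p), ⁅X1,X0⁆(p) = 0, and ⁅X2,X0⁆(p) = (1/y²)·X1(p). -/
/-- Lie bracket of vector fields on (an open subset of) ℝ³ = ℝ × ℝ × ℝ: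
⁅V,W⁆(p) = DW(p)(V(p)) − DV(p)(W(p)). -/
noncomputable def vlie (V W : ℝ × ℝ × ℝ → ℝ × ℝ × ℝ) : ℝ × ℝ × ℝ → ℝ × ℝ × ℝ :=
  fun p => fderiv ℝ W p (V p) - fderiv ℝ V p (W p)

/-- Directional derivative X(f) : p ↦ Df(p)(X(p)). -/
noncomputable def vder (X : ℝ × ℝ × ℝ → ℝ × ℝ × ℝ) (f : ℝ × ℝ × ℝ → ℝ) : ℝ × ℝ × ℝ → ℝ :=
  fun p => fderiv ℝ f p (X p)

/-- The flat Martinet orthonormal frame X1 = ∂x + (y²/2)∂z. -/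
noncomputable def X1 : ℝ × ℝ × ℝ → ℝ × ℝ × ℝ := fun p => (1, 0, p.2.1 ^ 2 / 2)

/-- X2 = ∂y − (xy/2)∂z. -/
noncomputable def X2 : ℝ × ℝ × ℝ → ℝ × ℝ × ℝ := fun p => (0, 1, -(p.1 * p.2.1) / 2)

/-- The Reeb field X0 = −(1/y)∂x + y∂z on {y ≠ 0}. -/
noncomputable def X0 : ℝ × ℝ × ℝ → ℝ × ℝ × ℝ := fun p => (-(1 / p.2.1), 0, p.2.1)

theorem fderiv_X1_apply (p v : ℝ × ℝ × ℝ) :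
    fderiv ℝ X1 p v = (0, 0, p.2.1 * v.2.1) := by
  have hy : HasFDerivAt (fun q : ℝ × ℝ × ℝ => q.2.1) _ p := (hasFDerivAt_snd (𝕜 := ℝ)).fst
  have h : HasFDerivAt X1 _ p :=
    (hasFDerivAt_const (1 : ℝ) p).prodMk
      ((hasFDerivAt_const (0 : ℝ) p).prodMk ((hy.pow 2).mul_const (2⁻¹ : ℝ)))
  rw [h.fderiv]
  ext <;> simp
  ring

theorem fderiv_X2_apply (p v : ℝ × ℝ × ℝ) :
    fderiv ℝ X2 p v = (0, 0, -(p.1 * v.2.1 + p.2.1 * v.1) / 2) := by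
  have hx : HasFDerivAt (fun q : ℝ × ℝ × ℝ => q.1) _ p := hasFDerivAt_fst (𝕜 := ℝ)
  have hy : HasFDerivAt (fun q : ℝ × ℝ × ℝ => q.2.1) _ p := (hasFDerivAt_snd (𝕜 := ℝ)).fst
  have h : HasFDerivAt X2 _ p :=
    (hasFDerivAt_const (0 : ℝ) p).prodMk
      ((hasFDerivAt_const (1 : ℝ) p).prodMk ((hx.mul hy).neg.mul_const (2⁻¹ : ℝ)))
  rw [h.fderiv]
  ext <;> simp
  ring

theorem fderiv_X0_apply {p : ℝ × ℝ × ℝ} (hp : p.2.1 ≠ 0) (v : ℝ × ℝ × ℝ) :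
    fderiv ℝ X0 p v = (v.2.1 / p.2.1 ^ 2, 0, v.2.1) := by
  have hy : HasFDerivAt (fun q : ℝ × ℝ × ℝ => q.2.1) _ p := (hasFDerivAt_snd (𝕜 := ℝ)).fst
  have hinv : HasFDerivAt (fun q : ℝ × ℝ × ℝ => -(q.2.1)⁻¹) _ p :=
    ((hasDerivAt_inv hp).comp_hasFDerivAt p hy).neg
  have h : HasFDerivAt (fun q : ℝ × ℝ × ℝ => (-(q.2.1)⁻¹, (0 : ℝ), q.2.1)) _ p :=
    hinv.prodMk ((hasFDerivAt_const (0 : ℝ) p).prodMk hy)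
  have hX0 : X0 = fun q : ℝ × ℝ × ℝ => (-(q.2.1)⁻¹, (0 : ℝ), q.2.1) := by
    funext q
    simp [X0]
  rw [hX0, h.fderiv]
  ext <;> simp
  ring

/-- Flat Martinet structure bracket relations on U = {y ≠ 0}:
⁅X2,X1⁆ = (1/y)·X1 + X0, ⁅X1,X0⁆ = 0, ⁅X2,X0⁆ = (1/y²)·X1. -/
theorem flat_martinet_brackets :
    ∀ p : ℝ × ℝ × ℝ, p.2.1 ≠ 0 →
      vlie X2 X1 p = (1 / p.2.1) • X1 p + X0 p ∧
      vlie X1 X0 p = 0 ∧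
      vlie X2 X0 p = (1 / p.2.1 ^ 2) • X1 p := by
  intro p hp
  simp only [vlie, fderiv_X1_apply, fderiv_X2_apply, fderiv_X0_apply hp]
  refine ⟨?_, ?_, ?_⟩ <;> ext <;> simp [X0, X1, X2] <;> field_simp <;> ring
end

section
/- (Invariants of the flat Martinet structure.) Let U = {(x,y,z) ∈ ℝ³ : y ≠ 0}, X1(x,y,z) = (1, 0, y²/2), X2(x,y,z) = (0, 1, −x·y/2), and take the structure functions c12^1(x,y,z) = 1/y, c02^1(x,y,z) = 1/y², and c01^1 = c01^2 = c02^2 = c12^2 = 0. Then the invariant κ := X2(c12^1) + X1(c12^2) − (c12^1)² + (c12^2)² − (1/2)·(c01^2 + c02^1) satisfies κ(x,y,z) = −5/(2y²) on U, and the invariant χ := −(c01^1)² + (1/4)·(c02^1 − c01^2)² satisfies χ(x,y,z) = 1/(4y⁴) on U. -/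
theorem vder_X2_comp_snd_fst {g : ℝ → ℝ} {g' : ℝ} {p : ℝ × ℝ × ℝ}
    (hg : HasDerivAt g g' p.2.1) : vder X2 (fun q => g q.2.1) p = g' := by
  have hy : HasFDerivAt (fun q : ℝ × ℝ × ℝ => q.2.1)
      ((ContinuousLinearMap.fst ℝ ℝ ℝ).comp (ContinuousLinearMap.snd ℝ ℝ (ℝ × ℝ))) p :=
    hasFDerivAt_snd.fst
  have h : HasFDerivAt (fun q : ℝ × ℝ × ℝ => g q.2.1) _ p := hg.comp_hasFDerivAt p hy
  simp [vder, h.fderiv, X2]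

/-- Invariants of the flat Martinet structure: with c12^1 = 1/y, c02^1 = 1/y²,
c01^1 = c01^2 = c02^2 = c12^2 = 0, one has κ = −5/(2y²) and χ = 1/(4y⁴) on {y ≠ 0}. -/
theorem flat_martinet_invariants
    (c121 c021 c011 c012 c022 c122 : ℝ × ℝ × ℝ → ℝ)
    (hc121 : c121 = fun p => 1 / p.2.1)
    (hc021 : c021 = fun p => 1 / p.2.1 ^ 2)
    (hc011 : c011 = fun _ => 0) (hc012 : c012 = fun _ => 0)
    (hc022 : c022 = fun _ => 0) (hc122 : c122 = fun _ => 0)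
    (κ χ : ℝ × ℝ × ℝ → ℝ)
    (hκ : κ = fun p =>
      vder X2 c121 p + vder X1 c122 p - (c121 p) ^ 2 + (c122 p) ^ 2 -
        (1 / 2) * (c012 p + c021 p))
    (hχ : χ = fun p => -(c011 p) ^ 2 + (1 / 4) * (c021 p - c012 p) ^ 2) :
    ∀ p : ℝ × ℝ × ℝ, p.2.1 ≠ 0 →
      κ p = -5 / (2 * p.2.1 ^ 2) ∧ χ p = 1 / (4 * p.2.1 ^ 4) := by
  subst hc121 hc021 hc011 hc012 hc022 hc122 hκ hχ
  intro p hp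
  have h2 : vder X2 (fun q => 1 / q.2.1) p = -(p.2.1 ^ 2)⁻¹ := by
    simpa only [one_div] using vder_X2_comp_snd_fst (hasDerivAt_inv hp)
  have h1 : vder X1 (fun _ => 0) p = 0 := by simp [vder]
  simp only [h1, h2]
  constructor <;> (field_simp; ring)
end
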